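/- arXiv:1008.1266 — 2 statements merged into one kernel-verified Lean document; each statement's English description precedes it below -/
import Mathlib

section
/- Let Ẽ_0(a) := min σ(h^N_{0,Λ} − q_a). Assume (H1) and that either (i) d ≥ 2 and q ≠ 0 is sign-definite, or (ii) d = 1 and Ẽ_0(a) ≠ −2 for at least one a ∈ [0, M_1−b_1]. Then the configuration ω* is spectrally maximizing: for every ω ∈ Ω = Δ^{ℤ^d} one has max σ(h_ω) ≤ max σ(h_{ω*}). -/
open scoped BigOperators

noncomputable section

/-- Points of the lattice `ℤ^d`. -/
abbrev Zd (d : ℕ) := Fin d → ℤ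

/-- 1-norm distance on `ℤ^d`. -/
def dist1 {d : ℕ} (x y : Zd d) : ℤ := ∑ i, |x i - y i|

/-- The set of nearest neighbors of a point of `ℤ^d`. -/
def nbhd {d : ℕ} (n : Zd d) : Finset (Zd d) :=
  (Fintype.piFinset fun i => Finset.Icc (n i - 1) (n i + 1)).filter fun m => dist1 n m = 1

/-- A discrete box `∏ [lo i, hi i]`. -/
def dbox {d : ℕ} (lo hi : Zd d) : Finset (Zd d) :=
  Fintype.piFinset fun i => Finset.Icc (lo i) (hi i)

/-- `n_S(i)`: the number of nearest neighbors of `i` lying outside `S`. -/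
def nOut {d : ℕ} (S : Finset (Zd d)) (i : Zd d) : ℕ :=
  ((nbhd i).filter fun j => j ∉ S).card

/-- The matrix of the Neumann Laplacian `h^N_{0,S}` plus a potential `V` on the finite
set `S ⊂ ℤ^d`. -/
def neumannMat {d : ℕ} (S : Finset (Zd d)) (V : Zd d → ℝ) : Matrix S S ℝ :=
  fun i j => (if dist1 (i : Zd d) (j : Zd d) = 1 then (-1 : ℝ) else 0)
    + (if i = j then (V (i : Zd d) - (nOut S (i : Zd d) : ℝ)) else 0)

/-- `E_0(a) = min σ(h^N_{0,Λ} + q_a)` for `Λ = ∏ [1, M i]`. -/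
def E0 {d : ℕ} (M : Zd d) (q : Zd d → ℝ) (a : Zd d) : ℝ :=
  sInf (spectrum ℝ (neumannMat (dbox (fun _ => 1) M) (fun n => q (n - a))))

/-- `ℓ²(ℤ^d)` with real coefficients. -/
abbrev l2 (d : ℕ) := lp (fun _ : Zd d => ℝ) 2

/-- The displacement potential `V_ω = ∑_k q_{kM + ω_k}`, evaluated pointwise:
`V_ω(n) = ∑_k q(n - kM - ω_k)`. -/
def Vpot {d : ℕ} (M : Zd d) (q : Zd d → ℝ) (ω : Zd d → Zd d) (n : Zd d) : ℝ :=
  ∑' k : Zd d, q (fun i => n i - k i * M i - ω k i)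

/-- A displacement configuration is admissible if each `ω_k ∈ Δ = ∏ [0, M i - b i]`. -/
def adm {d : ℕ} (M b : Zd d) (ω : Zd d → Zd d) : Prop :=
  ∀ k i, 0 ≤ ω k i ∧ ω k i ≤ M i - b i

/-- The special configuration `ω*`: `(ω*_k)_i = 0` if `k_i` is even, `M_i - b_i` if odd. -/
def ωstar {d : ℕ} (M b : Zd d) : Zd d → Zd d :=
  fun k i => if Even (k i) then 0 else M i - b i

/-! ### The top of the spectrum of a bounded symmetric operator -/

open scoped InnerProductSpace

section Spectrum

variable {E : Type*} [NormedAddCommGroup E] [InnerProductSpace ℝ E]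

/-- Numbers bounding the quadratic form of `T` from above. -/
def formBounds (T : E →L[ℝ] E) : Set ℝ := {c | ∀ x, ⟪T x, x⟫_ℝ ≤ c * ‖x‖ ^ 2}

lemma inner_algebraMap_sub_apply (T : E →L[ℝ] E) (c : ℝ) (x y : E) :
    ⟪(algebraMap ℝ (E →L[ℝ] E) c - T) x, y⟫_ℝ = c * ⟪x, y⟫_ℝ - ⟪T x, y⟫_ℝ := by
  simp [Algebra.algebraMap_eq_smul_one, inner_sub_left, inner_smul_left]

lemma le_of_mem_spectrum_of_mem_formBounds [CompleteSpace E] {T : E →L[ℝ] E} {c l : ℝ}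
    (hc : c ∈ formBounds T) (hl : l ∈ spectrum ℝ T) : l ≤ c := by
  by_contra! h
  refine hl ?_
  refine ContinuousLinearMap.isUnit_of_forall_le_norm_inner_map (𝕜 := ℝ) _
    (c := (l - c).toNNReal) (by simpa using h) fun x => ?_
  refine le_trans ?_ (Real.le_norm_self _)
  rw [inner_algebraMap_sub_apply, real_inner_self_eq_norm_sq]
  have := hc x
  rw [Real.coe_toNNReal _ (by linarith)]
  nlinarith

lemma norm_sq_le_of_inner_nonneg {A : E →L[ℝ] E} (hA : A.IsSymmetric)
    (h0 : ∀ x, 0 ≤ ⟪A x, x⟫_ℝ) (x : E) : ‖A x‖ ^ 2 ≤ ‖A‖ * ⟪A x, x⟫_ℝ := by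
  let B : LinearMap.BilinForm ℝ E := (innerₗ E).comp (A : E →ₗ[ℝ] E)
  have hB : ∀ u v, B u v = ⟪A u, v⟫_ℝ := fun u v => rfl
  have h1 := LinearMap.BilinForm.apply_mul_apply_le_of_forall_zero_le B
    (fun u => by rw [hB]; exact h0 u) x (A x)
  have h2 : ⟪A (A x), x⟫_ℝ = ‖A x‖ ^ 2 := by
    rw [← real_inner_self_eq_norm_sq]; exact hA (A x) x
  have h3 : ⟪A (A x), A x⟫_ℝ ≤ ‖A‖ * ‖A x‖ ^ 2 := by
    refine (real_inner_le_norm _ _).trans ?_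
    have := A.le_opNorm (A x)
    nlinarith [norm_nonneg (A x)]
  simp only [hB, h2, real_inner_self_eq_norm_sq] at h1
  rcases (sq_nonneg ‖A x‖).eq_or_lt with h | h
  · rw [← h]; exact mul_nonneg (norm_nonneg _) (h0 x)
  · have h4 := mul_le_mul_of_nonneg_left h3 (h0 x)
    refine le_of_mul_le_mul_right ?_ h
    nlinarith

lemma IsLeast.mem_spectrum {T : E →L[ℝ] E} (hT : T.IsSymmetric) {c : ℝ}
    (hc : IsLeast (formBounds T) c) : c ∈ spectrum ℝ T := by
  intro hu
  set A : E →L[ℝ] E := algebraMap ℝ (E →L[ℝ] E) c - T with hA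
  have hAin := inner_algebraMap_sub_apply T c
  have hAs : A.IsSymmetric := fun x y => by
    have h1 := hAin x y
    have h2 := hAin y x
    have h3 := hT x y
    simp only [ContinuousLinearMap.coe_coe] at h3 ⊢
    rw [real_inner_comm] at h2
    rw [h1, h2, h3, real_inner_comm x y, real_inner_comm x (T y)]
  have h0 : ∀ x, 0 ≤ ⟪A x, x⟫_ℝ := fun x => by
    rw [hAin, real_inner_self_eq_norm_sq]; linarith [hc.1 x]
  obtain ⟨B, hB⟩ := hu
  have hinv : ∀ x, ‖x‖ ≤ ‖(↑B⁻¹ : E →L[ℝ] E)‖ * ‖A x‖ := fun x => by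
    have h1 : (↑B⁻¹ : E →L[ℝ] E) (A x) = x := by
      rw [hA, ← hB, ← mul_apply_eq_comp, Units.inv_mul]; rfl
    conv_lhs => rw [← h1]
    exact ContinuousLinearMap.le_opNorm _ _
  set β := ‖(↑B⁻¹ : E →L[ℝ] E)‖
  set K := β ^ 2 * ‖A‖ + 1
  have hK : 0 < K := by positivity
  have hbd : ∀ x, ‖x‖ ^ 2 ≤ K * ⟪A x, x⟫_ℝ := fun x => by
    have h1 := norm_sq_le_of_inner_nonneg hAs h0 x
    have h2 : ‖x‖ ^ 2 ≤ β ^ 2 * ‖A x‖ ^ 2 := by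
      rw [← mul_pow]; exact pow_le_pow_left₀ (norm_nonneg _) (hinv x) 2
    have h3 := mul_le_mul_of_nonneg_left h1 (sq_nonneg β)
    have := h0 x
    simp only [K]; nlinarith
  have hmem : c - 1 / K ∈ formBounds T := fun x => by
    have h1 := hbd x
    rw [hAin, real_inner_self_eq_norm_sq] at h1
    have h2 : 1 / K * ‖x‖ ^ 2 ≤ c * ‖x‖ ^ 2 - ⟪T x, x⟫_ℝ := by
      rw [one_div, inv_mul_le_iff₀ hK]; exact h1
    linarith
  have := hc.2 hmem
  have : 0 < 1 / K := by positivity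
  linarith

lemma exists_isLeast_formBounds [Nontrivial E] (T : E →L[ℝ] E) :
    ∃ c, IsLeast (formBounds T) c := by
  have hne : (formBounds T).Nonempty := ⟨‖T‖, fun x => by
    refine (real_inner_le_norm _ _).trans ?_
    nlinarith [T.le_opNorm x, norm_nonneg x]⟩
  have hdiv : ∀ {x : E}, x ≠ 0 → ∀ {c}, c ∈ formBounds T → ⟪T x, x⟫_ℝ / ‖x‖ ^ 2 ≤ c :=
    fun {x} hx {c} hc => by
      have : 0 < ‖x‖ := norm_pos_iff.2 hx
      rw [div_le_iff₀ (by positivity)]; exact hc x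
  obtain ⟨x₀, hx₀⟩ := exists_ne (0 : E)
  refine ⟨sInf (formBounds T), fun x => ?_, fun c hc => csInf_le ⟨_, fun c hc => hdiv hx₀ hc⟩ hc⟩
  rcases eq_or_ne x 0 with rfl | hx
  · simp
  · have : 0 < ‖x‖ := norm_pos_iff.2 hx
    rw [← div_le_iff₀ (by positivity)]
    exact le_csInf hne fun c hc => hdiv hx hc

lemma isLeast_formBounds_sSup_spectrum [CompleteSpace E] [Nontrivial E] {T : E →L[ℝ] E}
    (hT : T.IsSymmetric) : IsLeast (formBounds T) (sSup (spectrum ℝ T)) := by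
  obtain ⟨c, hc⟩ := exists_isLeast_formBounds T
  have : IsGreatest (spectrum ℝ T) c :=
    ⟨hc.mem_spectrum hT, fun l hl => le_of_mem_spectrum_of_mem_formBounds hc.1 hl⟩
  rwa [this.csSup_eq]

end Spectrum

/-! ### Neumann forms on a box -/

section Box

variable {d : ℕ}

lemma mem_dbox {lo hi n : Zd d} : n ∈ dbox lo hi ↔ ∀ i, lo i ≤ n i ∧ n i ≤ hi i := by
  simp [dbox]

/-- Move by `+1` in direction `i`, staying below the upper face `n i = M i`. -/
def stepUp (M : Zd d) (i : Fin d) (n : Zd d) : Zd d :=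
  Function.update n i (min (n i + 1) (M i))

/-- Move by `-1` in direction `i`, staying above the lower face `n i = 1`. -/
def stepDown (i : Fin d) (n : Zd d) : Zd d :=
  Function.update n i (max (n i - 1) 1)

/-- The box `∏ [1, M i]`. -/
abbrev cell (M : Zd d) : Finset (Zd d) := dbox (fun _ => 1) M

lemma stepUp_mem {M n : Zd d} (hM : ∀ i, 1 ≤ M i) (i : Fin d) (hn : n ∈ cell M) :
    stepUp M i n ∈ cell M := by
  rw [mem_dbox] at hn ⊢
  intro j
  have h1 := hn j
  have h2 := hM j
  rcases eq_or_ne j i with rfl | hj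
  · simp only [stepUp, Function.update_self]; omega
  · simpa [stepUp, Function.update_of_ne hj] using h1

lemma stepDown_mem {M n : Zd d} (hM : ∀ i, 1 ≤ M i) (i : Fin d) (hn : n ∈ cell M) :
    stepDown i n ∈ cell M := by
  rw [mem_dbox] at hn ⊢
  intro j
  have h1 := hn j
  have h2 := hM j
  rcases eq_or_ne j i with rfl | hj
  · simp only [stepDown, Function.update_self]; omega
  · simpa [stepDown, Function.update_of_ne hj] using h1

lemma stepUp_of_eq {M n : Zd d} {i : Fin d} (h : n i = M i) : stepUp M i n = n := by
  have : min (n i + 1) (M i) = n i := by omega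
  rw [stepUp, this, Function.update_eq_self]

lemma stepDown_of_eq {n : Zd d} {i : Fin d} (h : n i = 1) : stepDown i n = n := by
  have : max (n i - 1) 1 = n i := by omega
  rw [stepDown, this, Function.update_eq_self]

lemma stepDown_stepUp {M n : Zd d} {i : Fin d} (hn : n ∈ cell M) (h : n i ≠ M i) :
    stepDown i (stepUp M i n) = n := by
  have h1 := mem_dbox.1 hn i
  have : max (min (n i + 1) (M i) - 1) 1 = n i := by omega
  simp [stepDown, stepUp, this]

lemma stepUp_stepDown {M n : Zd d} {i : Fin d} (hn : n ∈ cell M) (h : n i ≠ 1) :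
    stepUp M i (stepDown i n) = n := by
  have h1 := mem_dbox.1 hn i
  have : min (max (n i - 1) 1 + 1) (M i) = n i := by omega
  simp [stepDown, stepUp, this]

lemma stepUp_comm (M : Zd d) {i j : Fin d} (n : Zd d) :
    stepUp M i (stepUp M j n) = stepUp M j (stepUp M i n) := by
  rcases eq_or_ne i j with rfl | h
  · rfl
  · simp [stepUp, Function.update_of_ne h, Function.update_of_ne h.symm, Function.update_comm h]

lemma stepDown_stepUp_comm (M : Zd d) {i j : Fin d} (h : i ≠ j) (n : Zd d) :
    stepDown i (stepUp M j n) = stepUp M j (stepDown i n) := by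
  simp [stepUp, stepDown, Function.update_of_ne h, Function.update_of_ne h.symm,
    Function.update_comm h]

lemma sum_filter_stepUp {M : Zd d} (hM : ∀ i, 1 ≤ M i) (i : Fin d) (F : Zd d → ℝ) :
    ∑ n ∈ (cell M).filter (fun n => n i ≠ M i), F (stepUp M i n)
      = ∑ n ∈ (cell M).filter (fun n => n i ≠ 1), F n := by
  refine Finset.sum_bij' (fun n _ => stepUp M i n) (fun n _ => stepDown i n) ?_ ?_ ?_ ?_ ?_
  · intro n hn
    rw [Finset.mem_filter] at hn ⊢
    refine ⟨stepUp_mem hM i hn.1, ?_⟩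
    have := mem_dbox.1 hn.1 i
    have := hn.2
    simp only [stepUp, Function.update_self]; omega
  · intro n hn
    rw [Finset.mem_filter] at hn ⊢
    refine ⟨stepDown_mem hM i hn.1, ?_⟩
    have := mem_dbox.1 hn.1 i
    have := hn.2
    simp only [stepDown, Function.update_self]; omega
  · intro n hn
    rw [Finset.mem_filter] at hn
    exact stepDown_stepUp hn.1 hn.2
  · intro n hn
    rw [Finset.mem_filter] at hn
    exact stepUp_stepDown hn.1 hn.2
  · intro n hn
    rfl

lemma sum_cell_split (M : Zd d) (i : Fin d) (t : ℤ) (F : Zd d → ℝ) :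
    ∑ n ∈ cell M, F n = ∑ n ∈ (cell M).filter (fun n => n i = t), F n
      + ∑ n ∈ (cell M).filter (fun n => n i ≠ t), F n :=
  (Finset.sum_filter_add_sum_filter_not _ _ _).symm

lemma sum_stepUp {M : Zd d} (hM : ∀ i, 1 ≤ M i) (i : Fin d) (F : Zd d → ℝ) :
    ∑ n ∈ cell M, F (stepUp M i n) = ∑ n ∈ cell M, F n
      + ∑ n ∈ (cell M).filter (fun n => n i = M i), F n
      - ∑ n ∈ (cell M).filter (fun n => n i = 1), F n := by
  rw [sum_cell_split M i (M i) fun n => F (stepUp M i n), sum_filter_stepUp hM,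
    sum_cell_split M i 1 F]
  rw [Finset.sum_congr rfl fun n hn => by rw [stepUp_of_eq (Finset.mem_filter.1 hn).2]]
  ring

lemma sum_stepDown {M : Zd d} (hM : ∀ i, 1 ≤ M i) (i : Fin d) (F : Zd d → ℝ) :
    ∑ n ∈ cell M, F (stepDown i n) = ∑ n ∈ cell M, F n
      + ∑ n ∈ (cell M).filter (fun n => n i = 1), F n
      - ∑ n ∈ (cell M).filter (fun n => n i = M i), F n := by
  rw [sum_cell_split M i 1 fun n => F (stepDown i n), ← sum_filter_stepUp hM,
    sum_cell_split M i (M i) F]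
  rw [Finset.sum_congr rfl fun n hn => by rw [stepDown_of_eq (Finset.mem_filter.1 hn).2],
    Finset.sum_congr (f := fun n => F (stepDown i (stepUp M i n))) rfl fun n hn => by
      rw [stepDown_stepUp (Finset.mem_filter.1 hn).1 (Finset.mem_filter.1 hn).2]]
  ring

/-- The squared difference of `v` across the bond from `n` to `stepUp M j n`. -/
def bond (M : Zd d) (v : Zd d → ℝ) (j : Fin d) (n : Zd d) : ℝ := (v (stepUp M j n) - v n) ^ 2

/-- The squared norm of `v` on the box. -/
def mass (M : Zd d) (v : Zd d → ℝ) : ℝ := ∑ n ∈ cell M, v n ^ 2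

/-- Potential energy minus Neumann kinetic energy on the box. -/
def boxForm (M : Zd d) (V v : Zd d → ℝ) : ℝ :=
  ∑ n ∈ cell M, V n * v n ^ 2 - ∑ j, ∑ n ∈ cell M, bond M v j n

lemma bond_nonneg (M : Zd d) (v : Zd d → ℝ) (j : Fin d) (n : Zd d) : 0 ≤ bond M v j n :=
  sq_nonneg _

lemma mass_nonneg (M : Zd d) (v : Zd d → ℝ) : 0 ≤ mass M v :=
  Finset.sum_nonneg fun _ _ => sq_nonneg _

lemma mass_eq_zero_iff {M : Zd d} {v : Zd d → ℝ} : mass M v = 0 ↔ ∀ n ∈ cell M, v n = 0 := by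
  rw [mass, Finset.sum_eq_zero_iff_of_nonneg fun _ _ => sq_nonneg _]
  simp

lemma mass_shift_add {M : Zd d} (hM : ∀ i, 1 ≤ M i) (i : Fin d) (v : Zd d → ℝ) :
    mass M (fun n => v (stepUp M i n)) + mass M (fun n => v (stepDown i n)) = 2 * mass M v := by
  have h1 := sum_stepUp hM i fun n => v n ^ 2
  have h2 := sum_stepDown hM i fun n => v n ^ 2
  simp only [mass]
  linarith

lemma sum_bond_top (M : Zd d) (v : Zd d → ℝ) (i : Fin d) :
    ∑ n ∈ (cell M).filter (fun n => n i = M i), bond M v i n = 0 :=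
  Finset.sum_eq_zero fun n hn => by
    simp [bond, stepUp_of_eq (Finset.mem_filter.1 hn).2]

lemma bond_shift_add_le {M : Zd d} (hM : ∀ i, 1 ≤ M i) (i j : Fin d) (v : Zd d → ℝ) :
    ∑ n ∈ cell M, bond M (fun n => v (stepUp M i n)) j n
      + ∑ n ∈ cell M, bond M (fun n => v (stepDown i n)) j n
      + (if j = i then ∑ n ∈ (cell M).filter (fun n => n i = 1), bond M v i n else 0)
      ≤ 2 * ∑ n ∈ cell M, bond M v j n := by
  have h1 : ∑ n ∈ cell M, bond M (fun n => v (stepUp M i n)) j n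
      = ∑ n ∈ cell M, bond M v j (stepUp M i n) :=
    Finset.sum_congr rfl fun n _ => by simp only [bond]; rw [stepUp_comm]
  rw [h1, sum_stepUp hM]
  rcases eq_or_ne j i with rfl | hj
  · rw [if_pos rfl, sum_bond_top]
    have h2 : ∑ n ∈ cell M, bond M (fun n => v (stepDown j n)) j n
        ≤ ∑ n ∈ cell M, bond M v j n := by
      rw [sum_cell_split M j 1, sum_cell_split M j (M j) (bond M v j), sum_bond_top, zero_add]
      have h3 : ∑ n ∈ (cell M).filter (fun n => n j = 1),
          bond M (fun n => v (stepDown j n)) j n = 0 :=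
        Finset.sum_eq_zero fun n hn => by
          obtain ⟨hn1, hn2⟩ := Finset.mem_filter.1 hn
          simp only [bond, stepDown_of_eq hn2]
          rcases eq_or_ne (n j) (M j) with h | h
          · rw [stepUp_of_eq h, stepDown_of_eq hn2]; ring
          · rw [stepDown_stepUp hn1 h]; ring
      rw [h3, zero_add, ← sum_filter_stepUp hM]
      refine Finset.sum_le_sum fun n hn => ?_
      obtain ⟨hn1, hn2⟩ := Finset.mem_filter.1 hn
      simp only [bond, stepDown_stepUp hn1 hn2]
      rcases eq_or_ne (stepUp M j n j) (M j) with h | h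
      · rw [stepUp_of_eq h, stepDown_stepUp hn1 hn2]
        simpa using sq_nonneg _
      · rw [stepDown_stepUp (stepUp_mem hM j hn1) h]
    linarith
  · rw [if_neg hj]
    have h2 : ∑ n ∈ cell M, bond M (fun n => v (stepDown i n)) j n
        = ∑ n ∈ cell M, bond M v j (stepDown i n) :=
      Finset.sum_congr rfl fun n _ => by
        simp only [bond]; rw [stepDown_stepUp_comm M hj.symm]
    rw [h2, sum_stepDown hM]
    linarith

lemma boxForm_shift_add {M : Zd d} (hM : ∀ i, 1 ≤ M i) (i : Fin d) (v : Zd d → ℝ)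
    {W Wd Wu : Zd d → ℝ} (hd : ∀ n ∈ cell M, Wd n = W (stepUp M i n))
    (hu : ∀ n ∈ cell M, Wu n = W (stepDown i n)) :
    2 * boxForm M W v + ∑ n ∈ (cell M).filter (fun n => n i = 1), bond M v i n
      ≤ boxForm M Wd (fun n => v (stepUp M i n)) + boxForm M Wu (fun n => v (stepDown i n)) := by
  have h1 : ∑ n ∈ cell M, Wd n * v (stepUp M i n) ^ 2
      = ∑ n ∈ cell M, (fun n => W n * v n ^ 2) (stepUp M i n) :=
    Finset.sum_congr rfl fun n hn => by rw [hd n hn]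
  have h2 : ∑ n ∈ cell M, Wu n * v (stepDown i n) ^ 2
      = ∑ n ∈ cell M, (fun n => W n * v n ^ 2) (stepDown i n) :=
    Finset.sum_congr rfl fun n hn => by rw [hu n hn]
  have h3 := Finset.sum_le_sum fun j (_ : j ∈ Finset.univ) => bond_shift_add_le hM i j v
  rw [Finset.sum_add_distrib, Finset.sum_add_distrib, Finset.sum_ite_eq' Finset.univ i,
    if_pos (Finset.mem_univ i), ← Finset.mul_sum] at h3
  simp only [boxForm]
  rw [h1, h2, sum_stepUp hM i fun n => W n * v n ^ 2, sum_stepDown hM i fun n => W n * v n ^ 2]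
  linarith

/-- The reflection of the box in direction `i`. -/
def reflect (M : Zd d) (i : Fin d) (n : Zd d) : Zd d := Function.update n i (M i + 1 - n i)

lemma reflect_reflect (M : Zd d) (i : Fin d) (n : Zd d) : reflect M i (reflect M i n) = n := by
  simp [reflect]

lemma reflect_mem {M n : Zd d} (i : Fin d) (hn : n ∈ cell M) : reflect M i n ∈ cell M := by
  rw [mem_dbox] at hn ⊢
  intro j
  have h1 := hn j
  rcases eq_or_ne j i with rfl | hj
  · simp only [reflect, Function.update_self]; omega
  · simpa [reflect, Function.update_of_ne hj] using h1

lemma sum_reflect (M : Zd d) (i : Fin d) (F : Zd d → ℝ) :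
    ∑ n ∈ cell M, F (reflect M i n) = ∑ n ∈ cell M, F n :=
  Finset.sum_nbij' (reflect M i) (reflect M i) (fun _ hn => reflect_mem i hn)
    (fun _ hn => reflect_mem i hn) (fun _ _ => reflect_reflect M i _)
    (fun _ _ => reflect_reflect M i _) (fun _ _ => rfl)

lemma sum_bond_stepDown {M : Zd d} (hM : ∀ i, 1 ≤ M i) (i : Fin d) (v : Zd d → ℝ) :
    ∑ n ∈ cell M, (v (stepDown i n) - v n) ^ 2 = ∑ n ∈ cell M, bond M v i n := by
  rw [sum_cell_split M i 1, sum_cell_split M i (M i) (bond M v i), sum_bond_top,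
    Finset.sum_eq_zero fun n hn => by simp [stepDown_of_eq (Finset.mem_filter.1 hn).2],
    ← sum_filter_stepUp hM]
  congr 1
  refine Finset.sum_congr rfl fun n hn => ?_
  rw [stepDown_stepUp (Finset.mem_filter.1 hn).1 (Finset.mem_filter.1 hn).2, bond]
  ring

lemma reflect_stepUp (M : Zd d) (i : Fin d) (n : Zd d) :
    reflect M i (stepUp M i n) = stepDown i (reflect M i n) := by
  have : M i + 1 - min (n i + 1) (M i) = max (M i + 1 - n i - 1) 1 := by omega
  simp [reflect, stepUp, stepDown, this]

lemma reflect_stepUp_of_ne (M : Zd d) {i j : Fin d} (h : i ≠ j) (n : Zd d) :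
    reflect M i (stepUp M j n) = stepUp M j (reflect M i n) := by
  simp [stepUp, reflect, Function.update_of_ne h, Function.update_of_ne h.symm,
    Function.update_comm h]

lemma mass_reflect (M : Zd d) (i : Fin d) (v : Zd d → ℝ) :
    mass M (fun n => v (reflect M i n)) = mass M v :=
  sum_reflect M i fun n => v n ^ 2

lemma boxForm_reflect {M : Zd d} (hM : ∀ i, 1 ≤ M i) (i : Fin d) {V V' : Zd d → ℝ}
    (hV : ∀ n, V' n = V (reflect M i n)) (v : Zd d → ℝ) :
    boxForm M V' (fun n => v (reflect M i n)) = boxForm M V v := by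
  simp only [boxForm]
  congr 1
  · rw [← sum_reflect M i fun n => V n * v n ^ 2]
    exact Finset.sum_congr rfl fun n _ => by rw [hV]
  · refine Finset.sum_congr rfl fun j _ => ?_
    rcases eq_or_ne i j with rfl | h
    · rw [← sum_bond_stepDown hM i v, ← sum_reflect M i fun n => (v (stepDown i n) - v n) ^ 2]
      exact Finset.sum_congr rfl fun n _ => by simp only [bond]; rw [reflect_stepUp]
    · rw [← sum_reflect M i (bond M v j)]
      exact Finset.sum_congr rfl fun n _ => by simp only [bond]; rw [reflect_stepUp_of_ne M h]

lemma mass_congr {M : Zd d} {v w : Zd d → ℝ} (h : ∀ n ∈ cell M, v n = w n) :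
    mass M v = mass M w :=
  Finset.sum_congr rfl fun n hn => by rw [h n hn]

lemma boxForm_congr {M : Zd d} (hM : ∀ i, 1 ≤ M i) {V v w : Zd d → ℝ}
    (h : ∀ n ∈ cell M, v n = w n) : boxForm M V v = boxForm M V w := by
  simp only [boxForm]
  congr 1
  · exact Finset.sum_congr rfl fun n hn => by rw [h n hn]
  · refine Finset.sum_congr rfl fun j _ => Finset.sum_congr rfl fun n hn => ?_
    simp only [bond]
    rw [h n hn, h _ (stepUp_mem hM j hn)]

lemma mass_smul (M : Zd d) (c : ℝ) (v : Zd d → ℝ) :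
    mass M (fun n => c * v n) = c ^ 2 * mass M v := by
  simp only [mass, mul_pow, Finset.mul_sum]

lemma boxForm_smul (M : Zd d) (V : Zd d → ℝ) (c : ℝ) (v : Zd d → ℝ) :
    boxForm M V (fun n => c * v n) = c ^ 2 * boxForm M V v := by
  simp only [boxForm, bond, mul_sub, Finset.mul_sum]
  congr 1
  · exact Finset.sum_congr rfl fun n _ => by ring
  · exact Finset.sum_congr rfl fun j _ => Finset.sum_congr rfl fun n _ => by ring

lemma exists_maximizer {M : Zd d} (hM : ∀ i, 1 ≤ M i) (V : Zd d → ℝ) :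
    ∃ v, mass M v = 1 ∧ ∀ w, boxForm M V w ≤ boxForm M V v * mass M w := by
  classical
  let K : Set (Zd d → ℝ) := {v | (∀ n, n ∉ cell M → v n = 0) ∧ mass M v = 1}
  have hsub : K ⊆ Set.univ.pi fun _ => Set.Icc (-1 : ℝ) 1 := by
    rintro v ⟨h0, h1⟩ n -
    by_cases hn : n ∈ cell M
    · have : v n ^ 2 ≤ mass M v :=
        Finset.single_le_sum (f := fun n => v n ^ 2) (fun _ _ => sq_nonneg _) hn
      rw [h1] at this
      exact abs_le.1 ((sq_le_one_iff_abs_le_one _).1 this)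
    · rw [h0 n hn]; simp
  have hmass : Continuous (mass M) := by unfold mass; fun_prop
  have hform : Continuous (boxForm M V) := by unfold boxForm bond; fun_prop
  have hclosed : IsClosed K := by
    have : K = (⋂ n, ⋂ (_ : n ∉ cell M), {v : Zd d → ℝ | v n = 0}) ∩ {v | mass M v = 1} := by
      ext v; simp [K]
    rw [this]
    exact (isClosed_iInter fun n => isClosed_iInter fun _ =>
      isClosed_eq (continuous_apply n) continuous_const).inter
      (isClosed_eq hmass continuous_const)
  have hcomp : IsCompact K :=
    (isCompact_univ_pi fun _ => isCompact_Icc).of_isClosed_subset hclosed hsub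
  have hone : (fun _ => 1 : Zd d) ∈ cell M := mem_dbox.2 fun i => ⟨le_rfl, hM i⟩
  have hne : K.Nonempty := by
    refine ⟨fun n => if n = (fun _ => 1) then 1 else 0, fun n hn => ?_, ?_⟩
    · refine if_neg ?_; rintro rfl; exact hn hone
    · simp [mass, ite_pow, hone]
  obtain ⟨v, hv, hmax⟩ := hcomp.exists_isMaxOn hne hform.continuousOn
  refine ⟨v, hv.2, fun w => ?_⟩
  set m := mass M w with hm
  rcases (mass_nonneg M w).eq_or_lt with h | h
  · have h0 : ∀ n ∈ cell M, w n = (fun n => 0 * w n) n := fun n hn => by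
      simp [mass_eq_zero_iff.1 h.symm n hn]
    rw [boxForm_congr hM h0, boxForm_smul, hm, ← h]; simp
  · let c := (Real.sqrt m)⁻¹
    have hc : c ^ 2 = m⁻¹ := by simp only [c, inv_pow]; rw [Real.sq_sqrt h.le]
    let w' : Zd d → ℝ := fun n => if n ∈ cell M then c * w n else 0
    have hw' : ∀ n ∈ cell M, w' n = c * w n := fun n hn => if_pos hn
    have hK : w' ∈ K := ⟨fun n hn => if_neg hn, by
      rw [mass_congr hw', mass_smul, hc]; exact inv_mul_cancel₀ h.ne'⟩
    have := hmax hK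
    rw [Set.mem_ofPred_eq, boxForm_congr hM hw', boxForm_smul, hc, inv_mul_le_iff₀ h] at this
    linarith

/-- `μ` is attained as a Rayleigh quotient of the box form with potential `V`. -/
def Attains (M : Zd d) (μ : ℝ) (V : Zd d → ℝ) : Prop :=
  ∃ v, mass M v ≠ 0 ∧ boxForm M V v = μ * mass M v

lemma Attains.shift {M : Zd d} (hM : ∀ i, 1 ≤ M i) {i : Fin d} {μ : ℝ} {W Wd Wu : Zd d → ℝ}
    (hW : Attains M μ W) (hd : ∀ n ∈ cell M, Wd n = W (stepUp M i n))
    (hu : ∀ n ∈ cell M, Wu n = W (stepDown i n))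
    (hμd : ∀ w, boxForm M Wd w ≤ μ * mass M w) (hμu : ∀ w, boxForm M Wu w ≤ μ * mass M w) :
    Attains M μ Wd := by
  obtain ⟨v, hv, hE⟩ := hW
  have h1 := boxForm_shift_add hM i v hd hu
  have h2 := mass_shift_add hM i v
  have h3 := hμd fun n => v (stepUp M i n)
  have h4 := hμu fun n => v (stepDown i n)
  have h5 : 0 ≤ ∑ n ∈ (cell M).filter (fun n => n i = 1), bond M v i n :=
    Finset.sum_nonneg fun _ _ => bond_nonneg _ _ _ _
  have h6 : μ * mass M (fun n => v (stepUp M i n)) + μ * mass M (fun n => v (stepDown i n))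
      = 2 * (μ * mass M v) := by rw [← mul_add, h2]; ring
  refine ⟨fun n => v (stepUp M i n), fun h0 => hv ?_, by linarith⟩
  have h7 : ∑ n ∈ (cell M).filter (fun n => n i = 1), bond M v i n = 0 := by linarith
  rw [Finset.sum_eq_zero_iff_of_nonneg fun _ _ => bond_nonneg _ _ _ _] at h7
  rw [mass_eq_zero_iff] at h0 ⊢
  intro n hn
  by_cases h8 : n i = 1
  · have h9 := h7 n (Finset.mem_filter.2 ⟨hn, h8⟩)
    rw [bond, h0 n hn] at h9
    simpa using h9
  · simpa [stepUp_stepDown hn h8] using h0 _ (stepDown_mem hM i hn)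

lemma Attains.reflect {M : Zd d} (hM : ∀ i, 1 ≤ M i) {i : Fin d} {μ : ℝ} {V V' : Zd d → ℝ}
    (h : Attains M μ V) (hV : ∀ n, V' n = V (reflect M i n)) : Attains M μ V' := by
  obtain ⟨v, hv, hE⟩ := h
  exact ⟨fun n => v (_root_.reflect M i n), by rwa [mass_reflect],
    by rw [boxForm_reflect hM i hV, mass_reflect, hE]⟩

/-- Moving the single-site potential to a corner of the box maximizes the top of the Neumann
form. -/
lemma boxForm_le_of_corner {M b : Zd d} (hb : ∀ i, 1 ≤ b i) (hbM : ∀ i, b i ≤ M i)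
    {q : Zd d → ℝ} (hsupp : ∀ n, n ∉ dbox (fun _ => 1) b → q n = 0)
    (hH1 : ∀ (x : Zd d) (i : Fin d), q x = q (Function.update x i (b i - x i + 1)))
    {c : ℝ} (hc : ∀ v, boxForm M q v ≤ c * mass M v)
    {a : Zd d} (ha : ∀ i, 0 ≤ a i ∧ a i ≤ M i - b i) (v : Zd d → ℝ) :
    boxForm M (fun n => q (n - a)) v ≤ c * mass M v := by
  classical
  have hM : ∀ i, 1 ≤ M i := fun i => (hb i).trans (hbM i)
  have hq0 : ∀ (n : Zd d) (i : Fin d), n i < 1 ∨ b i < n i → q n = 0 := fun n i h =>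
    hsupp n fun hn => by have := mem_dbox.1 hn i; omega
  let D : Finset (Zd d) := dbox 0 (M - b)
  have hD : ∀ a, a ∈ D ↔ ∀ i, 0 ≤ a i ∧ a i ≤ M i - b i := fun a => by simp [D, mem_dbox]
  have hDne : D.Nonempty := ⟨a, (hD a).2 ha⟩
  choose u hu1 hu2 using fun a : Zd d => exists_maximizer hM fun n => q (n - a)
  obtain ⟨a₀, ha₀, hmax⟩ :=
    D.exists_max_image (fun a => boxForm M (fun n => q (n - a)) (u a)) hDne
  set μ := boxForm M (fun n => q (n - a₀)) (u a₀)
  have hμ : ∀ a ∈ D, ∀ w, boxForm M (fun n => q (n - a)) w ≤ μ * mass M w := fun a ha w =>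
    (hu2 a w).trans (mul_le_mul_of_nonneg_right (hmax a ha) (mass_nonneg M w))
  let S := D.filter fun a => Attains M μ fun n => q (n - a)
  have hS : S.Nonempty := ⟨a₀, Finset.mem_filter.2 ⟨ha₀, u a₀, by rw [hu1]; simp, by
    rw [hu1, mul_one]⟩⟩
  obtain ⟨e, heS, hmin⟩ := S.exists_min_image (fun a => ∑ i, a i) hS
  obtain ⟨heD, heA⟩ := Finset.mem_filter.1 heS
  have hlt : ∀ (i : Fin d) (t : ℤ), 0 ≤ t → t < e i →
      ¬ Attains M μ fun n => q (n - Function.update e i t) := by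
    intro i t ht hte hA
    have hmem : Function.update e i t ∈ S := by
      refine Finset.mem_filter.2 ⟨(hD _).2 fun j => ?_, hA⟩
      have h1 := (hD e).1 heD j
      rcases eq_or_ne j i with rfl | hj
      · simp only [Function.update_self]; omega
      · simpa [Function.update_of_ne hj] using h1
    have h2 := hmin _ hmem
    refine absurd h2 (not_le.2 (Finset.sum_lt_sum (fun j _ => ?_) ⟨i, Finset.mem_univ i, ?_⟩))
    · rcases eq_or_ne j i with rfl | hj
      · simpa using hte.le
      · simp [Function.update_of_ne hj]
    · simpa using hte
  have he0 : e = 0 := by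
    funext i
    by_contra hne
    have h1 := (hD e).1 heD i
    have hpos : 1 ≤ e i := by
      have : e i ≠ 0 := hne
      omega
    rcases h1.2.lt_or_eq with h2 | h2
    · have hdn : ∀ t, 0 ≤ t → t ≤ M i - b i → Function.update e i t ∈ D := fun t h3 h4 => by
        refine (hD _).2 fun j => ?_
        rcases eq_or_ne j i with rfl | hj
        · simpa using ⟨h3, h4⟩
        · simpa [Function.update_of_ne hj] using (hD e).1 heD j
      refine hlt i (e i - 1) (by omega) (by omega) ?_
      refine heA.shift hM (i := i) (Wu := fun n => q (n - Function.update e i (e i + 1)))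
        (fun n hn => ?_) (fun n hn => ?_) (hμ _ (hdn _ (by omega) (by omega)))
        (hμ _ (hdn _ (by omega) (by omega)))
      · have hni := mem_dbox.1 hn i
        rcases eq_or_ne (n i) (M i) with h3 | h3
        · rw [stepUp_of_eq h3, hq0 _ i (by simp; omega), hq0 _ i (by simp; omega)]
        · congr 1
          funext j
          rcases eq_or_ne j i with rfl | hj
          · simp [stepUp]; omega
          · simp [stepUp, Function.update_of_ne hj]
      · have hni := mem_dbox.1 hn i
        rcases eq_or_ne (n i) 1 with h3 | h3
        · rw [stepDown_of_eq h3, hq0 _ i (by simp; omega), hq0 _ i (by simp; omega)]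
        · congr 1
          funext j
          rcases eq_or_ne j i with rfl | hj
          · simp [stepDown]; omega
          · simp [stepDown, Function.update_of_ne hj]
    · refine hlt i 0 le_rfl (by omega) (heA.reflect hM (i := i) fun n => ?_)
      rw [hH1 _ i]
      congr 1
      funext j
      rcases eq_or_ne j i with rfl | hj
      · simp [_root_.reflect]; omega
      · simp [_root_.reflect, Function.update_of_ne hj]
  subst he0
  obtain ⟨w, hw, hE⟩ := heA
  simp only [sub_zero] at hE
  have h1 := hc w
  rw [hE] at h1
  have h2 : μ ≤ c := le_of_mul_le_mul_right h1 (lt_of_le_of_ne (mass_nonneg M w) hw.symm)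
  exact (hμ a ((hD a).2 ha) v).trans (mul_le_mul_of_nonneg_right h2 (mass_nonneg M v))

end Box

/-! ### Lattice geometry -/

section Lattice

variable {d : ℕ}

/-- The unit vector in direction `i`. -/
abbrev unitVec (i : Fin d) : Zd d := Pi.single i 1

lemma dist1_eq_one_iff {n m : Zd d} :
    dist1 n m = 1 ↔ ∃ i, m = n + unitVec i ∨ m = n - unitVec i := by
  constructor
  · intro h
    have h0 : ∃ i, n i ≠ m i := by
      by_contra! hall
      simp [dist1, hall] at h
    obtain ⟨i, hi⟩ := h0
    rw [dist1, ← Finset.add_sum_erase _ _ (Finset.mem_univ i)] at h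
    have h1 : 0 ≤ ∑ j ∈ Finset.univ.erase i, |n j - m j| :=
      Finset.sum_nonneg fun _ _ => abs_nonneg _
    have h2 : 0 < |n i - m i| := abs_pos.2 (sub_ne_zero.2 hi)
    have h3 : ∑ j ∈ Finset.univ.erase i, |n j - m j| = 0 := by omega
    rw [Finset.sum_eq_zero_iff_of_nonneg fun _ _ => abs_nonneg _] at h3
    have h4 : ∀ j, j ≠ i → m j = n j := fun j hj => by
      have := abs_eq_zero.1 (h3 j (Finset.mem_erase.2 ⟨hj, Finset.mem_univ j⟩))
      omega
    have h5 : |n i - m i| = 1 := by omega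
    refine ⟨i, ?_⟩
    rcases (abs_eq zero_le_one).1 h5 with h6 | h6
    · right
      funext j
      rcases eq_or_ne j i with rfl | hj
      · simp; omega
      · simp [hj, h4 j hj]
    · left
      funext j
      rcases eq_or_ne j i with rfl | hj
      · simp; omega
      · simp [hj, h4 j hj]
  · rintro ⟨i, rfl | rfl⟩ <;> simp [dist1, Pi.single_apply, apply_ite abs]

lemma mem_nbhd {n m : Zd d} : m ∈ nbhd n ↔ ∃ i, m = n + unitVec i ∨ m = n - unitVec i := by
  rw [nbhd, Finset.mem_filter, dist1_eq_one_iff, and_iff_right_iff_imp]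
  rintro ⟨i, h⟩
  rw [Fintype.mem_piFinset]
  intro j
  rw [Finset.mem_Icc]
  rcases h with rfl | rfl <;> rcases eq_or_ne j i with rfl | hj <;> simp [*] <;> omega

lemma unitVec_coord_cases {i j : Fin d} (h : i ≠ j) :
    unitVec i ≠ unitVec j ∧ unitVec i ≠ -unitVec j := by
  constructor <;> intro h' <;> simpa [h] using congrFun h' i

lemma sum_nbhd (n : Zd d) (f : Zd d → ℝ) :
    ∑ m ∈ nbhd n, f m = ∑ i, (f (n + unitVec i) + f (n - unitVec i)) := by
  classical
  have h1 : nbhd n = Finset.univ.biUnion fun i => {n + unitVec i, n - unitVec i} := by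
    ext m; simp [mem_nbhd]
  rw [h1, Finset.sum_biUnion]
  · refine Finset.sum_congr rfl fun i _ => Finset.sum_pair fun h => ?_
    have := congrFun h i
    simp at this
    omega
  · intro i _ j _ hij
    have h2 := unitVec_coord_cases hij
    simp only [Function.onFun, sub_eq_add_neg, Finset.disjoint_insert_left,
      Finset.disjoint_singleton_left, Finset.mem_insert, Finset.mem_singleton, add_right_inj,
      neg_inj, not_or]
    exact ⟨h2, fun h => h2.2 (by rw [← h, neg_neg]), h2.1⟩

/-- Index of the box `∏ [k i * M i + 1, (k i + 1) * M i]` containing `n`. -/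
def block (M n : Zd d) : Zd d := fun i => (n i - 1) / M i

/-- Position of `n` inside its box. -/
def loc (M n : Zd d) : Zd d := fun i => (n i - 1) % M i + 1

/-- The site of the box with index `k` at position `m`. -/
def site (M k m : Zd d) : Zd d := fun i => k i * M i + m i

lemma site_block_loc (M n : Zd d) : site M (block M n) (loc M n) = n := by
  funext i
  have := Int.mul_ediv_add_emod (n i - 1) (M i)
  simp only [site, block, loc]
  linarith

lemma loc_mem {M : Zd d} (hM : ∀ i, 1 ≤ M i) (n : Zd d) : loc M n ∈ cell M := by
  rw [mem_dbox]
  intro i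
  have h1 := Int.emod_nonneg (n i - 1) (b := M i) (by have := hM i; omega)
  have h2 := Int.emod_lt_of_pos (n i - 1) (b := M i) (by have := hM i; omega)
  simp only [loc]
  omega

lemma ediv_emod_site {M k m : ℤ} (h1 : 1 ≤ m) (h2 : m ≤ M) :
    (k * M + m - 1) / M = k ∧ (k * M + m - 1) % M = m - 1 :=
  (Int.ediv_emod_unique (by omega)).2 ⟨by ring, by omega, by omega⟩

lemma block_site {M m : Zd d} (k : Zd d) (hm : m ∈ cell M) : block M (site M k m) = k := by
  funext i
  have := mem_dbox.1 hm i
  exact (ediv_emod_site this.1 this.2).1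

lemma loc_site {M m : Zd d} (k : Zd d) (hm : m ∈ cell M) : loc M (site M k m) = m := by
  funext i
  have := mem_dbox.1 hm i
  have := (ediv_emod_site (k := k i) this.1 this.2).2
  simp only [loc, site]
  omega

/-- Decomposition of the lattice into boxes. -/
def siteEquiv {M : Zd d} (hM : ∀ i, 1 ≤ M i) : Zd d × cell M ≃ Zd d where
  toFun p := site M p.1 p.2
  invFun n := (block M n, ⟨loc M n, loc_mem hM n⟩)
  left_inv p := by
    ext1
    · exact block_site _ p.2.2
    · exact Subtype.ext (loc_site _ p.2.2)
  right_inv n := site_block_loc M n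

lemma Vpot_eq {M b : Zd d} {q : Zd d → ℝ}
    (hsupp : ∀ n, n ∉ dbox (fun _ => 1) b → q n = 0) {ω : Zd d → Zd d} (hω : adm M b ω)
    (n : Zd d) : Vpot M q ω n = q (loc M n - ω (block M n)) := by
  rw [Vpot, tsum_eq_single (block M n)]
  · congr 1
    funext i
    have := congrFun (site_block_loc M n) i
    simp only [site] at this
    simp only [Pi.sub_apply]
    omega
  · intro k hk
    refine hsupp _ fun hmem => hk ?_
    have hm : (fun i => n i - k i * M i) ∈ cell M := by
      rw [mem_dbox] at hmem ⊢
      intro i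
      have h1 := hmem i
      have h2 := hω k i
      omega
    rw [← block_site k hm]
    congr 1
    funext i
    simp [site]

/-- Reflect the position `m` in all directions in which `k` is odd. -/
def mirror (M k m : Zd d) : Zd d := fun i => if Even (k i) then m i else M i + 1 - m i

lemma mirror_mem {M m : Zd d} (k : Zd d) (hm : m ∈ cell M) : mirror M k m ∈ cell M := by
  rw [mem_dbox] at hm ⊢
  intro i
  have := hm i
  simp only [mirror]
  split_ifs <;> omega

lemma mirror_mirror (M k m : Zd d) : mirror M k (mirror M k m) = m := by
  funext i
  simp only [mirror]
  split_ifs <;> omega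

lemma sum_mirror (M k : Zd d) (F : Zd d → ℝ) :
    ∑ m ∈ cell M, F (mirror M k m) = ∑ m ∈ cell M, F m :=
  Finset.sum_nbij' (mirror M k) (mirror M k) (fun _ hn => mirror_mem k hn)
    (fun _ hn => mirror_mem k hn) (fun _ _ => mirror_mirror M k _)
    (fun _ _ => mirror_mirror M k _) (fun _ _ => rfl)

/-- The folding map of the lattice onto the box generated by reflections at its faces. -/
def fold (M n : Zd d) : Zd d := mirror M (block M n) (loc M n)

lemma fold_mem {M : Zd d} (hM : ∀ i, 1 ≤ M i) (n : Zd d) : fold M n ∈ cell M :=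
  mirror_mem _ (loc_mem hM n)

lemma fold_site {M m : Zd d} (k : Zd d) (hm : m ∈ cell M) :
    fold M (site M k m) = mirror M k m := by
  rw [fold, block_site k hm, loc_site k hm]

lemma apply_eq_of_reflection_symm {b : Zd d} {q : Zd d → ℝ}
    (hH1 : ∀ (x : Zd d) (i : Fin d), q x = q (Function.update x i (b i - x i + 1)))
    {x y : Zd d} (h : ∀ i, y i = x i ∨ y i = b i - x i + 1) : q x = q y := by
  classical
  have key : ∀ s : Finset (Fin d), q x = q (fun i => if i ∈ s then y i else x i) := by
    intro s
    induction s using Finset.induction_on with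
    | empty => simp
    | insert i s hi ih =>
      rw [ih]
      rcases h i with h1 | h1
      · congr 1
        funext j
        rcases eq_or_ne j i with rfl | hj
        · simp [hi, h1]
        · simp [hj]
      · rw [hH1 _ i]
        congr 1
        funext j
        rcases eq_or_ne j i with rfl | hj
        · simp [hi, h1]
        · simp [hj]
  simpa using key Finset.univ

lemma adm_ωstar {M b : Zd d} (hbM : ∀ i, b i ≤ M i) : adm M b (ωstar M b) := by
  intro k i
  have := hbM i
  simp only [ωstar]
  split_ifs <;> omega

lemma Vpot_ωstar {M b : Zd d} (hbM : ∀ i, b i ≤ M i) {q : Zd d → ℝ}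
    (hsupp : ∀ n, n ∉ dbox (fun _ => 1) b → q n = 0)
    (hH1 : ∀ (x : Zd d) (i : Fin d), q x = q (Function.update x i (b i - x i + 1)))
    (n : Zd d) : Vpot M q (ωstar M b) n = q (fold M n) := by
  rw [Vpot_eq hsupp (adm_ωstar hbM)]
  refine apply_eq_of_reflection_symm hH1 fun i => ?_
  simp only [fold, mirror, ωstar, Pi.sub_apply]
  split_ifs <;> omega

lemma fold_add_unitVec {M : Zd d} (hM : ∀ i, 1 ≤ M i) (n : Zd d) (i : Fin d) :
    fold M (n + unitVec i)
      = if Even (block M n i) then stepUp M i (fold M n) else stepDown i (fold M n) := by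
  funext j
  rcases eq_or_ne j i with rfl | hj
  · have hloc := mem_dbox.1 (loc_mem hM n) j
    have hn := congrFun (site_block_loc M n) j
    simp only [site] at hn
    by_cases hl : loc M n j = M j
    · have h1 : (n + unitVec j) j = (block M n j + 1) * M j + 1 := by
        simp only [Pi.add_apply, Pi.single_eq_same, ← hn, hl]; ring
      obtain ⟨h2, h3⟩ := ediv_emod_site (M := M j) (k := block M n j + 1) le_rfl (hM j)
      have hb : block M (n + unitVec j) j = block M n j + 1 := by rw [block, h1, h2]
      have hl' : loc M (n + unitVec j) j = 1 := by rw [loc, h1, h3]; rfl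
      simp only [fold, mirror, hb, hl', Int.even_add_one]
      by_cases hev : Even (block M n j) <;> simp [stepUp, stepDown, mirror, hev, hl]
    · have h1 : (n + unitVec j) j = block M n j * M j + (loc M n j + 1) := by
        simp only [Pi.add_apply, Pi.single_eq_same]; omega
      obtain ⟨h2, h3⟩ := ediv_emod_site (M := M j) (k := block M n j) (m := loc M n j + 1)
        (by omega) (by omega)
      have hb : block M (n + unitVec j) j = block M n j := by rw [block, h1, h2]
      have hl' : loc M (n + unitVec j) j = loc M n j + 1 := by rw [loc, h1, h3]; ring
      simp only [fold, mirror, hb, hl']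
      split_ifs with hev <;> simp [stepUp, stepDown, mirror, hev] <;> omega
  · have hb : block M (n + unitVec i) j = block M n j := by simp [block, hj]
    have hl : loc M (n + unitVec i) j = loc M n j := by simp [loc, hj]
    split_ifs <;> simp [fold, mirror, hb, hl, stepUp, stepDown, Function.update_of_ne hj]

lemma fold_sub_unitVec {M : Zd d} (hM : ∀ i, 1 ≤ M i) (n : Zd d) (i : Fin d) :
    fold M (n - unitVec i)
      = if Even (block M n i) then stepDown i (fold M n) else stepUp M i (fold M n) := by
  funext j
  rcases eq_or_ne j i with rfl | hj
  · have hloc := mem_dbox.1 (loc_mem hM n) j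
    have hn := congrFun (site_block_loc M n) j
    simp only [site] at hn
    by_cases hl : loc M n j = 1
    · have h1 : (n - unitVec j) j = (block M n j - 1) * M j + M j := by
        simp only [Pi.sub_apply, Pi.single_eq_same, ← hn, hl]; ring
      obtain ⟨h2, h3⟩ := ediv_emod_site (M := M j) (k := block M n j - 1) (hM j) le_rfl
      have hb : block M (n - unitVec j) j = block M n j - 1 := by rw [block, h1, h2]
      have hl' : loc M (n - unitVec j) j = M j := by rw [loc, h1, h3]; ring
      simp only [fold, mirror, hb, hl', Int.even_sub_one]
      by_cases hev : Even (block M n j) <;> simp [stepUp, stepDown, mirror, hev, hl]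
    · have h1 : (n - unitVec j) j = block M n j * M j + (loc M n j - 1) := by
        simp only [Pi.sub_apply, Pi.single_eq_same]; omega
      obtain ⟨h2, h3⟩ := ediv_emod_site (M := M j) (k := block M n j) (m := loc M n j - 1)
        (by omega) (by omega)
      have hb : block M (n - unitVec j) j = block M n j := by rw [block, h1, h2]
      have hl' : loc M (n - unitVec j) j = loc M n j - 1 := by rw [loc, h1, h3]; ring
      simp only [fold, mirror, hb, hl']
      split_ifs with hev <;> simp [stepUp, stepDown, mirror, hev] <;> omega
  · have hb : block M (n - unitVec i) j = block M n j := by simp [block, hj]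
    have hl : loc M (n - unitVec i) j = loc M n j := by simp [loc, hj]
    split_ifs <;> simp [fold, mirror, hb, hl, stepUp, stepDown, Function.update_of_ne hj]

end Lattice

/-! ### The quadratic form of the lattice operator -/

section Operator

variable {d : ℕ}

lemma summable_mul_of_sq {ι : Type*} {x y : ι → ℝ} (hx : Summable fun n => x n ^ 2)
    (hy : Summable fun n => y n ^ 2) : Summable fun n => x n * y n :=
  Summable.of_norm_bounded (hx.add hy) fun n => by
    rw [Real.norm_eq_abs, abs_le]
    constructor <;> nlinarith [sq_nonneg (x n + y n), sq_nonneg (x n - y n)]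

lemma summable_translate {f : Zd d → ℝ} (hf : Summable f) (e : Zd d) :
    Summable fun n => f (n + e) :=
  (Equiv.addRight e).summable_iff.2 hf

lemma hasSum_telescope {f : Zd d → ℝ} (hf : Summable f) (e : Zd d) :
    HasSum (fun n => f (n + e) - f n) 0 := by
  have h : HasSum (fun n => f (n + e)) (∑' n, f n) := (Equiv.addRight e).hasSum_iff.2 hf.hasSum
  simpa using h.sub hf.hasSum

lemma hasSum_telescope' {f : Zd d → ℝ} (hf : Summable f) (e : Zd d) :
    HasSum (fun n => f n - f (n - e)) 0 := by
  simpa [sub_eq_add_neg, add_comm] using (hasSum_telescope hf (-e)).neg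

lemma hasSum_mul_l2 (u w : l2 d) : HasSum (fun n => u n * w n) ⟪u, w⟫_ℝ := by
  simpa [mul_comm] using lp.hasSum_inner (𝕜 := ℝ) u w

lemma hasSum_sq_l2 (u : l2 d) : HasSum (fun n => u n ^ 2) (‖u‖ ^ 2) := by
  simpa [sq] using hasSum_mul_l2 u u

/-- `T` is the Schrödinger operator with potential `V`. -/
def IsSchrodinger (V : Zd d → ℝ) (T : l2 d →L[ℝ] l2 d) : Prop :=
  ∀ (u : l2 d) (n : Zd d), (T u) n = (-∑ j ∈ nbhd n, u j) + V n * u n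

lemma IsSchrodinger.isSymmetric {V : Zd d → ℝ} {T : l2 d →L[ℝ] l2 d} (hT : IsSchrodinger V T) :
    T.IsSymmetric := by
  intro u w
  have hu := (hasSum_sq_l2 u).summable
  have hw := (hasSum_sq_l2 w).summable
  have h1 := (hasSum_mul_l2 (T u) w).sub (hasSum_mul_l2 u (T w))
  have h2 : HasSum (fun n => ∑ i : Fin d,
      ((w (n + unitVec i) * u n - w (n - unitVec i + unitVec i) * u (n - unitVec i))
        - (u (n + unitVec i) * w n - u (n - unitVec i + unitVec i) * w (n - unitVec i))))
      (∑ i : Fin d, ((0 : ℝ) - 0)) :=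
    hasSum_sum fun i _ => by
      have hu' := summable_translate hu (unitVec i)
      have hw' := summable_translate hw (unitVec i)
      exact (hasSum_telescope' (summable_mul_of_sq hw' hu) (unitVec i)).sub
        (hasSum_telescope' (summable_mul_of_sq hu' hw) (unitVec i))
  have h3 := h1.unique (h2.congr_fun fun n => ?_)
  · simp at h3
    simp only [ContinuousLinearMap.coe_coe]
    linarith
  · simp only [hT u n, hT w n, sum_nbhd, sub_add_cancel]
    rw [add_mul, mul_add, neg_mul, mul_neg, Finset.sum_mul, Finset.mul_sum]
    have : ∀ i : Fin d, w (n + unitVec i) * u n - w n * u (n - unitVec i)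
        - (u (n + unitVec i) * w n - u n * w (n - unitVec i))
        = u n * (w (n + unitVec i) + w (n - unitVec i))
          - (u (n + unitVec i) + u (n - unitVec i)) * w n := fun i => by ring
    rw [Finset.sum_congr rfl fun i _ => this i, Finset.sum_sub_distrib]
    ring

/-- The staggered sign `(-1) ^ (n₁ + ⋯ + n_d)`. -/
def stagger (n : Zd d) : ℝ := (-1) ^ (∑ i, n i)

lemma stagger_mul_self (n : Zd d) : stagger n * stagger n = 1 := by
  rw [stagger, ← mul_zpow]; simp

lemma stagger_sq (n : Zd d) : stagger n ^ 2 = 1 := by rw [sq, stagger_mul_self]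

lemma stagger_add (n : Zd d) (i : Fin d) : stagger (n + unitVec i) = -stagger n := by
  have : ∑ j, (n + unitVec i) j = ∑ j, n j + 1 := by simp [Finset.sum_add_distrib]
  rw [stagger, this, zpow_add₀ (by norm_num), stagger]; simp

lemma stagger_sub (n : Zd d) (i : Fin d) : stagger (n - unitVec i) = -stagger n := by
  have := stagger_add (n - unitVec i) i
  rw [sub_add_cancel] at this
  rw [this, neg_neg]

/-- The density of the quadratic form at a site in terms of the staggered function. -/
lemma IsSchrodinger.apply_mul {V : Zd d → ℝ} {T : l2 d →L[ℝ] l2 d} (hT : IsSchrodinger V T)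
    (u : l2 d) {x : Zd d → ℝ} (hx : ∀ n, u n = stagger n * x n) (n : Zd d) :
    (T u) n * u n
      = ∑ i, x n * (x (n + unitVec i) + x (n - unitVec i)) + V n * x n ^ 2 := by
  rw [hT u n, sum_nbhd, add_mul, neg_mul, Finset.sum_mul, ← Finset.sum_neg_distrib]
  have hs := stagger_mul_self n
  congr 1
  · refine Finset.sum_congr rfl fun i _ => ?_
    rw [hx, hx, hx, stagger_add, stagger_sub]
    linear_combination (x n * (x (n + unitVec i) + x (n - unitVec i))) * hs
  · rw [hx]
    linear_combination (V n * x n ^ 2) * hs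

lemma IsSchrodinger.hasSum_form {V : Zd d → ℝ} {T : l2 d →L[ℝ] l2 d} (hT : IsSchrodinger V T)
    (u : l2 d) {x : Zd d → ℝ} (hx : ∀ n, u n = stagger n * x n) :
    HasSum (fun n => 2 * d * x n ^ 2 - ∑ i, (x (n + unitVec i) - x n) ^ 2 + V n * x n ^ 2)
      ⟪T u, u⟫_ℝ := by
  have hsq : ∀ n, u n ^ 2 = x n ^ 2 := fun n => by rw [hx, mul_pow, stagger_sq, one_mul]
  have hxs : Summable fun n => x n ^ 2 := by simpa only [hsq] using (hasSum_sq_l2 u).summable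
  have h2 : HasSum (fun n => ∑ i : Fin d,
      ((x (n + unitVec i) * x n - x (n - unitVec i + unitVec i) * x (n - unitVec i))
        - (x (n + unitVec i) ^ 2 - x n ^ 2))) (∑ i : Fin d, ((0 : ℝ) - 0)) :=
    hasSum_sum fun i _ =>
      (hasSum_telescope' (summable_mul_of_sq (summable_translate hxs (unitVec i)) hxs)
        (unitVec i)).sub (hasSum_telescope hxs (unitVec i))
  have h3 := (hasSum_mul_l2 (T u) u).add h2
  simp only [sub_zero, Finset.sum_const_zero, add_zero] at h3
  refine h3.congr_fun fun n => ?_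
  rw [hT.apply_mul u hx n]
  have h4 : (2 * d * x n ^ 2 : ℝ) = ∑ _i : Fin d, 2 * x n ^ 2 := by simp; ring
  rw [h4, add_right_comm, ← Finset.sum_add_distrib, ← Finset.sum_sub_distrib]
  congr 1
  refine Finset.sum_congr rfl fun i _ => ?_
  rw [sub_add_cancel]
  ring

lemma site_stepUp {M m : Zd d} (k : Zd d) {i : Fin d} (hm : m ∈ cell M) (h : m i ≠ M i) :
    site M k (stepUp M i m) = site M k m + unitVec i := by
  have := mem_dbox.1 hm i
  funext j
  rcases eq_or_ne j i with rfl | hj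
  · simp [site, stepUp]; omega
  · simp [site, stepUp, hj]

lemma bond_le {M m : Zd d} (k : Zd d) (x : Zd d → ℝ) (i : Fin d) (hm : m ∈ cell M) :
    bond M (fun m => x (site M k m)) i m ≤ (x (site M k m + unitVec i) - x (site M k m)) ^ 2 := by
  by_cases h : m i = M i
  · simpa [bond, stepUp_of_eq h] using sq_nonneg _
  · rw [bond, site_stepUp k hm h]

/-- Neumann bracketing: bounds for the Neumann forms on all boxes bound the full operator. -/
lemma IsSchrodinger.mem_formBounds {M : Zd d} (hM : ∀ i, 1 ≤ M i) {V : Zd d → ℝ}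
    {T : l2 d →L[ℝ] l2 d} (hT : IsSchrodinger V T) {c : ℝ}
    (hc : ∀ k v, boxForm M (fun m => V (site M k m)) v ≤ c * mass M v) :
    2 * d + c ∈ formBounds T := by
  intro u
  have hx : ∀ n, u n = stagger n * (stagger n * u n) := fun n => by
    rw [← mul_assoc, stagger_mul_self, one_mul]
  set x : Zd d → ℝ := fun n => stagger n * u n
  have h1 := hT.hasSum_form u hx
  have h2 : HasSum (fun n => (2 * d + c) * x n ^ 2) ((2 * d + c) * ‖u‖ ^ 2) := by
    refine ((hasSum_sq_l2 u).congr_fun fun n => ?_).mul_left _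
    simp only [x, mul_pow, stagger_sq, one_mul]
  have h3 := ((siteEquiv hM).hasSum_iff.2 h1).prod_fiberwise fun k => hasSum_fintype _
  have h4 := ((siteEquiv hM).hasSum_iff.2 h2).prod_fiberwise fun k => hasSum_fintype _
  refine hasSum_le (fun k => ?_) h3 h4
  let v : Zd d → ℝ := fun m => x (site M k m)
  have e1 := Finset.sum_coe_sort (cell M) fun m => 2 * d * x (site M k m) ^ 2
    - ∑ i, (x (site M k m + unitVec i) - x (site M k m)) ^ 2
    + V (site M k m) * x (site M k m) ^ 2
  have e2 := Finset.sum_coe_sort (cell M) fun m => (2 * d + c) * x (site M k m) ^ 2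
  refine (le_of_eq e1).trans (le_trans ?_ (le_of_eq e2.symm))
  have h5 := hc k v
  have h6 : ∑ i, ∑ m ∈ cell M, bond M v i m
      ≤ ∑ m ∈ cell M, ∑ i, (x (site M k m + unitVec i) - x (site M k m)) ^ 2 := by
    rw [Finset.sum_comm]
    exact Finset.sum_le_sum fun m hm => Finset.sum_le_sum fun i _ => bond_le k x i hm
  rw [Finset.sum_add_distrib, Finset.sum_sub_distrib, ← Finset.mul_sum, ← Finset.mul_sum]
  simp only [boxForm, mass, v] at h5 h6
  linarith

/-- The density of the Neumann form on the box. -/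
def density (M : Zd d) (q v : Zd d → ℝ) (m : Zd d) : ℝ :=
  ∑ i, v m * (v (stepUp M i m) + v (stepDown i m)) + q m * v m ^ 2

lemma sum_density {M : Zd d} (hM : ∀ i, 1 ≤ M i) (q v : Zd d → ℝ) :
    ∑ m ∈ cell M, density M q v m = 2 * d * mass M v + boxForm M q v := by
  have h1 : ∀ i, ∑ m ∈ cell M, v m * (v (stepUp M i m) + v (stepDown i m))
      = 2 * mass M v - ∑ m ∈ cell M, bond M v i m := fun i => by
    have e1 := mass_shift_add hM i v
    have e2 := sum_bond_stepDown hM i v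
    have e3 : ∑ m ∈ cell M, 2 * (v m * (v (stepUp M i m) + v (stepDown i m)))
        = ∑ m ∈ cell M, (2 * v m ^ 2 + v (stepUp M i m) ^ 2 + v (stepDown i m) ^ 2
          - bond M v i m - (v (stepDown i m) - v m) ^ 2) :=
      Finset.sum_congr rfl fun m _ => by rw [bond]; ring
    rw [← Finset.mul_sum] at e3
    simp only [Finset.sum_sub_distrib, Finset.sum_add_distrib, ← Finset.mul_sum, e2] at e3
    simp only [mass] at e1 ⊢
    linarith
  simp only [density]
  rw [Finset.sum_add_distrib, Finset.sum_comm, Finset.sum_congr rfl fun i _ => h1 i,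
    Finset.sum_sub_distrib, boxForm]
  simp
  ring

lemma density_fold {M : Zd d} (hM : ∀ i, 1 ≤ M i) (q v : Zd d → ℝ) (n : Zd d) :
    density M q v (fold M n)
      = ∑ i, v (fold M n) * (v (fold M (n + unitVec i)) + v (fold M (n - unitVec i)))
        + q (fold M n) * v (fold M n) ^ 2 := by
  rw [density]
  congr 1
  refine Finset.sum_congr rfl fun i _ => ?_
  rw [fold_add_unitVec hM, fold_sub_unitVec hM]
  split_ifs
  · rfl
  · rw [add_comm (v (stepDown i _))]

/-- The box consisting of `L ^ d` copies of the basic box. -/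
abbrev bigCell (M : Zd d) (L : ℕ) : Finset (Zd d) := dbox (fun _ => 1) fun i => L * M i

lemma sum_bigCell_fold {M : Zd d} (hM : ∀ i, 1 ≤ M i) (L : ℕ) (F : Zd d → ℝ) :
    ∑ n ∈ bigCell M L, F (fold M n) = (L : ℝ) ^ d * ∑ m ∈ cell M, F m := by
  let K : Finset (Zd d) := dbox 0 fun _ => (L : ℤ) - 1
  have hK : (K.card : ℝ) = (L : ℝ) ^ d := by
    simp [K, dbox]
  have h1 : ∑ n ∈ bigCell M L, F (fold M n)
      = ∑ p ∈ K ×ˢ cell M, F (fold M (site M p.1 p.2)) := by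
    refine Finset.sum_bij' (fun n _ => (block M n, loc M n)) (fun p _ => site M p.1 p.2)
      ?_ ?_ ?_ ?_ ?_
    · intro n hn
      rw [Finset.mem_product]
      refine ⟨mem_dbox.2 fun i => ?_, loc_mem hM n⟩
      have h2 := mem_dbox.1 hn i
      have h3 : 0 < M i := by have := hM i; omega
      refine ⟨Int.ediv_nonneg (by omega) h3.le, ?_⟩
      have : (n i - 1) / M i < L := Int.ediv_lt_of_lt_mul h3 (by omega)
      simp only [block]; omega
    · intro p hp
      obtain ⟨hp1, hp2⟩ := Finset.mem_product.1 hp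
      refine mem_dbox.2 fun i => ?_
      have h2 := mem_dbox.1 hp1 i
      have h3 := mem_dbox.1 hp2 i
      have h4 := hM i
      simp only [Pi.zero_apply] at h2
      simp only [site]
      constructor <;> nlinarith
    · intro n hn
      exact site_block_loc M n
    · intro p hp
      obtain ⟨hp1, hp2⟩ := Finset.mem_product.1 hp
      rw [block_site _ hp2, loc_site _ hp2]
    · intro n hn
      rw [site_block_loc]
  rw [h1, Finset.sum_product]
  have h2 : ∀ k ∈ K, ∑ m ∈ cell M, F (fold M (site M k m)) = ∑ m ∈ cell M, F m := fun k _ => by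
    rw [← sum_mirror M k F]
    exact Finset.sum_congr rfl fun m hm => by rw [fold_site k hm]
  rw [Finset.sum_congr rfl h2, Finset.sum_const, nsmul_eq_mul, hK]

/-- The sites of the big box all of whose neighbors are in the big box. -/
abbrev innerCell (M : Zd d) (L : ℕ) : Finset (Zd d) := dbox (fun _ => 2) fun i => L * M i - 1

lemma card_bigCell_sub {M : Zd d} (hM : ∀ i, 1 ≤ M i) {L : ℕ} (hL : 2 ≤ L) :
    ((bigCell M L).card : ℝ) - (innerCell M L).card
      ≤ (L : ℝ) ^ d * ((∏ i, (M i : ℝ)) * (2 * d / L)) := by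
  have hLM : ∀ i, (2 : ℤ) ≤ L * M i := fun i => by
    have := hM i
    have : (2 : ℤ) ≤ L := by exact_mod_cast hL
    nlinarith
  have hL0 : (2 : ℝ) ≤ L := by exact_mod_cast hL
  have h1 : ((bigCell M L).card : ℝ) = (L : ℝ) ^ d * ∏ i, (M i : ℝ) := by
    have e : ∀ i, ((Finset.Icc 1 ((L : ℤ) * M i)).card : ℝ) = L * M i := fun i => by
      rw [Int.card_Icc, ← Int.cast_natCast, Int.toNat_of_nonneg (by have := hLM i; omega)]
      push_cast; ring
    simp only [bigCell, dbox, Fintype.card_piFinset, Nat.cast_prod, e, Finset.prod_mul_distrib]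
    simp
  have h2 : ((innerCell M L).card : ℝ) = ∏ i, ((L : ℝ) * M i - 2) := by
    have e : ∀ i, ((Finset.Icc 2 ((L : ℤ) * M i - 1)).card : ℝ) = L * M i - 2 := fun i => by
      rw [Int.card_Icc, ← Int.cast_natCast, Int.toNat_of_nonneg (by have := hLM i; omega)]
      push_cast; ring
    simp only [innerCell, dbox, Fintype.card_piFinset, Nat.cast_prod, e]
  have h3 : (L : ℝ) ^ d * (∏ i, (M i : ℝ)) * (1 - 2 / L) ^ d ≤ ∏ i, ((L : ℝ) * M i - 2) := by
    have : (L : ℝ) ^ d * (∏ i, (M i : ℝ)) * (1 - 2 / L) ^ d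
        = ∏ i, ((L : ℝ) * M i * (1 - 2 / L)) := by
      simp [Finset.prod_mul_distrib]
    rw [this]
    have hM' : ∀ i, (1 : ℝ) ≤ M i := fun i => by exact_mod_cast hM i
    have hpos : (0 : ℝ) ≤ 1 - 2 / L := by
      rw [sub_nonneg, div_le_one (by linarith)]; exact hL0
    refine Finset.prod_le_prod (fun i _ => ?_) fun i _ => ?_
    · have := hM' i
      positivity
    · have := hM' i
      field_simp
      nlinarith
  have h4 : 1 - 2 * d / L ≤ (1 - 2 / (L : ℝ)) ^ d := by
    have h5 : 2 / (L : ℝ) ≤ 1 := by rw [div_le_one (by linarith)]; exact hL0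
    have := one_add_mul_le_pow (a := -(2 / (L : ℝ))) (by linarith) d
    calc 1 - 2 * d / (L : ℝ) = 1 + d * -(2 / (L : ℝ)) := by ring
      _ ≤ _ := this
      _ = _ := by rw [← sub_eq_add_neg]
  have h5 : 0 ≤ (L : ℝ) ^ d * ∏ i, (M i : ℝ) :=
    mul_nonneg (by positivity) (Finset.prod_nonneg fun i _ => by
      exact_mod_cast (zero_le_one.trans (hM i)))
  have h6 := mul_le_mul_of_nonneg_left h4 h5
  rw [h1, h2]
  linarith

/-- The square-summable function that equals `f` on the finite set `s` and vanishes elsewhere. -/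
def truncate (s : Finset (Zd d)) (f : Zd d → ℝ) : l2 d :=
  ⟨fun n => if n ∈ s then f n else 0, memℓp_gen
    (hasSum_sum_of_ne_finset_zero (s := s) fun n hn => by simp [hn]).summable⟩

lemma truncate_apply (s : Finset (Zd d)) (f : Zd d → ℝ) (n : Zd d) :
    truncate s f n = if n ∈ s then f n else 0 := rfl

lemma boxForm_approx {M : Zd d} (hM : ∀ i, 1 ≤ M i) {q : Zd d → ℝ} {T : l2 d →L[ℝ] l2 d}
    (hT : IsSchrodinger (fun n => q (fold M n)) T) {c : ℝ} (hc : c ∈ formBounds T)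
    (v : Zd d → ℝ) {B : ℝ} (hB : ∀ m ∈ cell M, |v m| ≤ B) {L : ℕ} (hL : 2 ≤ L) :
    2 * d * mass M v + boxForm M q v - 2 * d * B ^ 2 * ((∏ i, (M i : ℝ)) * (2 * d / L))
      ≤ c * mass M v := by
  let R := bigCell M L
  let x : Zd d → ℝ := fun n => if n ∈ R then v (fold M n) else 0
  let u : l2 d := truncate R fun n => stagger n * v (fold M n)
  have hux : ∀ n, u n = stagger n * x n := fun n => by
    simp only [u, x, truncate_apply, mul_ite, mul_zero]
  have hxR : ∀ n ∈ R, x n = v (fold M n) := fun n hn => if_pos hn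
  have hu0 : ∀ n, n ∉ R → u n = 0 := fun n hn => by rw [truncate_apply, if_neg hn]
  have h1 : ‖u‖ ^ 2 = (L : ℝ) ^ d * mass M v := by
    have e : HasSum (fun n => u n ^ 2) (∑ n ∈ R, u n ^ 2) :=
      hasSum_sum_of_ne_finset_zero fun n hn => by simp [hu0 n hn]
    rw [(hasSum_sq_l2 u).unique e, mass, ← sum_bigCell_fold hM L fun m => v m ^ 2]
    exact Finset.sum_congr rfl fun n hn => by
      rw [hux, mul_pow, stagger_sq, one_mul, hxR n hn]
  have h2 : ⟪T u, u⟫_ℝ = ∑ n ∈ R, (T u) n * u n :=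
    (hasSum_mul_l2 (T u) u).unique (hasSum_sum_of_ne_finset_zero fun n hn => by
      simp [hu0 n hn])
  have hBf : ∀ n, |v (fold M n)| ≤ B := fun n => hB _ (fold_mem hM n)
  have hB0 : 0 ≤ B := (abs_nonneg _).trans (hBf 0)
  have hdiff : ∀ n m, v (fold M n) * (v (fold M m) - x m) ≤ B ^ 2 := fun n m => by
    refine (le_abs_self _).trans ?_
    rw [abs_mul, sq]
    refine mul_le_mul (hBf n) ?_ (abs_nonneg _) hB0
    simp only [x]
    split_ifs
    · simpa using hB0
    · simpa using hBf m
  have hsub : innerCell M L ⊆ R := fun n hn => mem_dbox.2 fun i => by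
    have := mem_dbox.1 hn i
    omega
  have h3 : ∀ n ∈ R, density M q v (fold M n)
      - (if n ∈ R \ innerCell M L then 2 * d * B ^ 2 else 0) ≤ (T u) n * u n := fun n hn => by
    rw [hT.apply_mul u hux n, density_fold hM, hxR n hn]
    split_ifs with hin
    · have : (2 * d * B ^ 2 : ℝ) = ∑ _i : Fin d, 2 * B ^ 2 := by simp; ring
      have h4 : ∑ i, v (fold M n) * (v (fold M (n + unitVec i)) + v (fold M (n - unitVec i)))
          ≤ ∑ i, (v (fold M n) * (x (n + unitVec i) + x (n - unitVec i)) + 2 * B ^ 2) :=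
        Finset.sum_le_sum fun i _ => by
          have := hdiff n (n + unitVec i)
          have := hdiff n (n - unitVec i)
          linarith
      rw [Finset.sum_add_distrib, ← this] at h4
      linarith
    · have hin' : n ∈ innerCell M L := by
        by_contra h
        exact hin (Finset.mem_sdiff.2 ⟨hn, h⟩)
      have hmem := mem_dbox.1 hin'
      have hnb : ∀ i, n + unitVec i ∈ R ∧ n - unitVec i ∈ R := fun i => by
        constructor <;> refine mem_dbox.2 fun j => ?_ <;> have h := hmem j <;>
          rcases eq_or_ne j i with rfl | hj
        · rw [Pi.add_apply, unitVec, Pi.single_eq_same]; omega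
        · rw [Pi.add_apply, unitVec, Pi.single_eq_of_ne hj]; omega
        · rw [Pi.sub_apply, unitVec, Pi.single_eq_same]; omega
        · rw [Pi.sub_apply, unitVec, Pi.single_eq_of_ne hj]; omega
      rw [sub_zero]
      refine le_of_eq ?_
      congr 1
      exact Finset.sum_congr rfl fun i _ => by rw [hxR _ (hnb i).1, hxR _ (hnb i).2]
  have h4 := Finset.sum_le_sum h3
  rw [← h2, Finset.sum_sub_distrib, sum_bigCell_fold hM L (density M q v), sum_density hM] at h4
  have h5 : ∑ n ∈ R, (if n ∈ R \ innerCell M L then 2 * d * B ^ 2 else 0)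
      = (((bigCell M L).card : ℝ) - (innerCell M L).card) * (2 * d * B ^ 2) := by
    rw [← Finset.sum_filter, Finset.sum_const, nsmul_eq_mul, ← Nat.cast_sub
      (Finset.card_le_card hsub), ← Finset.card_sdiff_of_subset hsub]
    congr 3
    ext n; simp
  have h6 := mul_le_mul_of_nonneg_right (card_bigCell_sub hM hL)
    (show (0 : ℝ) ≤ 2 * d * B ^ 2 by positivity)
  have h7 := hc u
  rw [h1] at h7
  have hLd : (0 : ℝ) < (L : ℝ) ^ d := by
    have : (0 : ℝ) < L := by exact_mod_cast (by omega : 0 < L)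
    positivity
  refine le_of_mul_le_mul_left ?_ hLd
  rw [h5] at h4
  linarith

/-- Reflecting a function on the box to the whole lattice shows that the Neumann form on the
box is bounded by the full operator with the folded potential. -/
lemma boxForm_le_of_mem_formBounds {M : Zd d} (hM : ∀ i, 1 ≤ M i) {q : Zd d → ℝ}
    {T : l2 d →L[ℝ] l2 d} (hT : IsSchrodinger (fun n => q (fold M n)) T) {c : ℝ}
    (hc : c ∈ formBounds T) (v : Zd d → ℝ) : boxForm M q v ≤ (c - 2 * d) * mass M v := by
  have hB : ∀ m ∈ cell M, |v m| ≤ ∑ m ∈ cell M, |v m| := fun m hm =>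
    Finset.single_le_sum (f := fun m => |v m|) (fun _ _ => abs_nonneg _) hm
  set B := ∑ m ∈ cell M, |v m|
  have hlim : Filter.Tendsto (fun L : ℕ => 2 * d * mass M v + boxForm M q v
      - 2 * d * B ^ 2 * ((∏ i, (M i : ℝ)) * (2 * d / L))) Filter.atTop
      (nhds (2 * d * mass M v + boxForm M q v - 2 * d * B ^ 2 * ((∏ i, (M i : ℝ)) * 0))) :=
    ((tendsto_const_div_atTop_nhds_zero_nat (2 * d : ℝ)).const_mul _ |>.const_mul _).const_sub _
  have := le_of_tendsto hlim (Filter.eventually_atTop.2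
    ⟨2, fun L hL => boxForm_approx hM hT hc v hB hL⟩)
  linarith

end Operator

/-- `ω*` is spectrally maximizing:  let `Ẽ_0(a) = min σ(h^N_{0,Λ} - q_a)`; assume (H1)
and either (i) `d ≥ 2` and `q ≠ 0` is sign-definite, or (ii) `d = 1` and `Ẽ_0(a) ≠ -2`
for at least one `a ∈ Δ`.  Then for every admissible configuration `ω`,
`max σ(h_ω) ≤ max σ(h_{ω*})`. -/
theorem omega_star_spectrally_maximizing
    (d : ℕ) (hd : 1 ≤ d) (M b : Zd d)
    (hb : ∀ i, 1 ≤ b i) (hbM : ∀ i, b i ≤ M i)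
    (q : Zd d → ℝ)
    (hsupp : ∀ n, n ∉ dbox (fun _ => 1) b → q n = 0)
    (hH1 : ∀ (x : Zd d) (i : Fin d), q x = q (Function.update x i (b i - x i + 1)))
    (hcase : (2 ≤ d ∧ q ≠ 0 ∧ ((∀ n, 0 ≤ q n) ∨ (∀ n, q n ≤ 0)))
      ∨ (d = 1 ∧ ∃ a : Zd d, (∀ i, 0 ≤ a i ∧ a i ≤ M i - b i) ∧ E0 M (fun n => -(q n)) a ≠ -2))
    (H : (Zd d → Zd d) → (l2 d →L[ℝ] l2 d))
    (hH : ∀ ω, adm M b ω → ∀ (u : l2 d) (n : Zd d),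
      (H ω u) n = (-∑ j ∈ nbhd n, u j) + Vpot M q ω n * u n) :
    ∀ ω, adm M b ω →
      sSup (spectrum ℝ (H ω)) ≤ sSup (spectrum ℝ (H (ωstar M b))) := by
  intro ω hω
  have hM : ∀ i, 1 ≤ M i := fun i => (hb i).trans (hbM i)
  have : Nontrivial (l2 d) := ⟨truncate {0} 1, 0, fun h => by
    have h0 := congrArg (fun u : l2 d => u 0) h
    simp [truncate_apply] at h0⟩
  have hS : IsSchrodinger (fun n => q (fold M n)) (H (ωstar M b)) := fun u n => by
    rw [hH _ (adm_ωstar hbM), Vpot_ωstar hbM hsupp hH1]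
  have hT : IsSchrodinger (Vpot M q ω) (H ω) := hH ω hω
  have hc := (isLeast_formBounds_sSup_spectrum hS.isSymmetric).1
  refine (isLeast_formBounds_sSup_spectrum hT.isSymmetric).2 ?_
  rw [← add_sub_cancel (2 * (d : ℝ)) (sSup (spectrum ℝ (H (ωstar M b))))]
  refine hT.mem_formBounds hM fun k v => ?_
  refine le_trans (le_of_eq ?_) (boxForm_le_of_corner hb hbM hsupp hH1
    (boxForm_le_of_mem_formBounds hM hS hc) (hω k) v)
  simp only [boxForm]
  congr 1
  exact Finset.sum_congr rfl fun m hm => by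
    rw [Vpot_eq hsupp hω, block_site k hm, loc_site k hm]
end
end

section
/- For every λ ∈ ℝ∖{0} and every configuration ω ∈ {0,1}^ℤ of the Bernoulli displacement model, the open interval (G_−(λ), G_+(λ)) is disjoint from σ(h_{ω,λ}), where G_±(λ) = λ/2 ± √(2 + λ²/4 − √(4+λ²)). -/
noncomputable section

/-- `ℓ²(ℤ)` with real coefficients. -/
abbrev l2Z := lp (fun _ : ℤ => ℝ) 2

open Classical in
/-- The potential of the Bernoulli displacement model: `V_ω(n) = λ` if
`n = 2k + 1 + ω_k` for some `k ∈ ℤ`, and `V_ω(n) = 0` otherwise. -/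
def Vbdm (lam : ℝ) (ω : ℤ → ℤ) (n : ℤ) : ℝ :=
  if ∃ k : ℤ, n = 2 * k + 1 + ω k then lam else 0

/-- The involution of `ℤ` exchanging the two sites `2k + 1`, `2k + 2` of each pair. -/
def swapInside (n : ℤ) : ℤ := if Even n then n - 1 else n + 1

/-- The involution of `ℤ` exchanging the sites `2k` and `2k + 1` of neighbouring pairs. -/
def swapAcross (n : ℤ) : ℤ := if Even n then n + 1 else n - 1

lemma swapInside_involutive : Function.Involutive swapInside := by
  intro n
  unfold swapInside
  grind

lemma swapAcross_involutive : Function.Involutive swapAcross := by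
  intro n
  unfold swapAcross
  grind

lemma swapAcross_add_swapInside (u : ℤ → ℝ) (n : ℤ) :
    u (n - 1) + u (n + 1) = u (swapAcross n) + u (swapInside n) := by
  unfold swapAcross swapInside
  split_ifs
  · exact add_comm _ _
  · rfl

lemma Vbdm_eq_zero_or (lam : ℝ) (ω : ℤ → ℤ) (n : ℤ) :
    Vbdm lam ω n = 0 ∨ Vbdm lam ω n = lam := by
  unfold Vbdm
  split_ifs <;> simp

lemma Vbdm_odd (lam : ℝ) {ω : ℤ → ℤ} (hω : ∀ k, ω k = 0 ∨ ω k = 1) (k : ℤ) :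
    Vbdm lam ω (2 * k + 1) = if ω k = 0 then lam else 0 := by
  unfold Vbdm
  congr 1
  refine propext ⟨?_, fun h => ⟨k, by omega⟩⟩
  rintro ⟨j, hj⟩
  have := hω j
  obtain rfl : j = k := by omega
  omega

lemma Vbdm_even (lam : ℝ) {ω : ℤ → ℤ} (hω : ∀ k, ω k = 0 ∨ ω k = 1) (k : ℤ) :
    Vbdm lam ω (2 * k + 2) = if ω k = 0 then 0 else lam := by
  rw [← ite_not]
  unfold Vbdm
  congr 1
  refine propext ⟨?_, fun h => ⟨k, by have := hω k; omega⟩⟩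
  rintro ⟨j, hj⟩
  have := hω j
  obtain rfl : j = k := by omega
  omega

lemma Vbdm_add_swapInside (lam : ℝ) {ω : ℤ → ℤ} (hω : ∀ k, ω k = 0 ∨ ω k = 1) (n : ℤ) :
    Vbdm lam ω n + Vbdm lam ω (swapInside n) = lam := by
  rcases Int.even_or_odd n with hn | hn
  · obtain ⟨k, rfl⟩ : ∃ k, n = 2 * k + 2 := by
      obtain ⟨m, rfl⟩ := hn
      exact ⟨m - 1, by ring⟩
    have h : swapInside (2 * k + 2) = 2 * k + 1 := by
      rw [swapInside, if_pos hn]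
      ring
    rw [h, Vbdm_odd lam hω, Vbdm_even lam hω]
    split_ifs <;> simp
  · obtain ⟨k, rfl⟩ := hn
    have h : swapInside (2 * k + 1) = 2 * k + 2 := by
      rw [swapInside, if_neg (by simp)]
      ring
    rw [h, Vbdm_odd lam hω, Vbdm_even lam hω]
    split_ifs <;> simp

lemma l2Z_hasSum_sq (u : l2Z) : HasSum (fun n => u n ^ 2) (‖u‖ ^ 2) := by
  simpa using lp.hasSum_norm (p := 2) (by norm_num) u

/-- Composition with an involution of `ℤ`, as a linear isometry of `ℓ²(ℤ)`. -/
def compInvolution {σ : ℤ → ℤ} (hσ : Function.Involutive σ) : l2Z →ₗᵢ[ℝ] l2Z where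
  toFun u := ⟨fun n => u (σ n), by
    refine memℓp_gen ?_
    simpa [Function.comp_def] using
      (l2Z_hasSum_sq u).summable.comp_injective hσ.injective⟩
  map_add' _ _ := rfl
  map_smul' _ _ := rfl
  norm_map' u := by
    refine (sq_eq_sq₀ (norm_nonneg _) (norm_nonneg _)).1 ?_
    exact (l2Z_hasSum_sq _).unique ((hσ.toPerm σ).hasSum_iff.2 (l2Z_hasSum_sq u))

lemma compInvolution_apply {σ : ℤ → ℤ} (hσ : Function.Involutive σ) (u : l2Z) (n : ℤ) :
    compInvolution hσ u n = u (σ n) := rfl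

/-- An operator acting on the orbits `{n, σ n}` of an involution by the trace-free symmetric blocks
with diagonal `w n = -w (σ n)` of modulus `|μ|` and off-diagonal entries `-1` multiplies norms by
`√(1 + μ²)`. -/
lemma norm_sq_block {σ : ℤ → ℤ} (hσ : Function.Involutive σ) {w : ℤ → ℝ} {μ : ℝ}
    (hw : ∀ n, w (σ n) = -w n) (hw2 : ∀ n, w n ^ 2 = μ ^ 2) {u v : l2Z}
    (huv : ∀ n, v n = -u (σ n) + w n * u n) :
    ‖v‖ ^ 2 = (1 + μ ^ 2) * ‖u‖ ^ 2 := by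
  have hv := l2Z_hasSum_sq v
  have hu := l2Z_hasSum_sq u
  have hvσ := (hσ.toPerm σ).hasSum_iff.2 hv
  have huσ := (hσ.toPerm σ).hasSum_iff.2 hu
  have h := (hv.add hvσ).unique (((hu.add huσ).mul_left (1 + μ ^ 2)).congr_fun ?_)
  · linarith
  · intro n
    simp only [Function.comp_apply, Function.Involutive.coe_toPerm, huv, hw, hσ n]
    linear_combination (u n ^ 2 + u (σ n) ^ 2) * hw2 n

/-- A perturbation of a square root `A` of `r²` of norm at most `r` by an operator of norm less
than `r` is invertible. -/
lemma isUnit_add_of_mul_self {R : Type*} [NormedRing R] [NormedAlgebra ℝ R] [HasSummableGeomSeries R]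
    {A C : R} {r : ℝ} (hr : 0 < r) (hA : A * A = algebraMap ℝ R (r ^ 2)) (hAr : ‖A‖ ≤ r)
    (hC : ‖C‖ < r) : IsUnit (A + C) := by
  have hr2 : r ^ 2 ≠ 0 := by positivity
  have hinv : A * ((r ^ 2)⁻¹ • A) = 1 := by
    rw [mul_smul_comm, hA, Algebra.algebraMap_eq_smul_one, smul_smul, inv_mul_cancel₀ hr2, one_smul]
  have hinv' : ((r ^ 2)⁻¹ • A) * A = 1 := by
    rw [smul_mul_assoc, ← mul_smul_comm, hinv]
  have hAu : IsUnit A := ⟨⟨A, _, hinv, hinv'⟩, rfl⟩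
  have hlt : ‖-((r ^ 2)⁻¹ • A * C)‖ < 1 := by
    rw [norm_neg]
    calc ‖(r ^ 2)⁻¹ • A * C‖ ≤ ‖(r ^ 2)⁻¹ • A‖ * ‖C‖ := norm_mul_le _ _
      _ = (r ^ 2)⁻¹ * (‖A‖ * ‖C‖) := by
        rw [norm_smul, Real.norm_of_nonneg (by positivity), mul_assoc]
      _ ≤ (r ^ 2)⁻¹ * (r * ‖C‖) := by gcongr
      _ < (r ^ 2)⁻¹ * (r * r) := by gcongr
      _ = 1 := by field_simp
  have h := hAu.mul (isUnit_one_sub_of_norm_lt_one hlt)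
  rwa [sub_neg_eq_add, mul_add, mul_one, ← mul_assoc, hinv, one_mul] at h

lemma sqrt_gap (lam : ℝ) :
    √(2 + lam ^ 2 / 4 - √(4 + lam ^ 2)) = √(1 + (lam / 2) ^ 2) - 1 := by
  have h1 : √(4 + lam ^ 2) = 2 * √(1 + (lam / 2) ^ 2) := by
    rw [show 4 + lam ^ 2 = 2 ^ 2 * (1 + (lam / 2) ^ 2) by ring,
      Real.sqrt_mul (by positivity), Real.sqrt_sq (by norm_num)]
  have h2 : 1 ≤ √(1 + (lam / 2) ^ 2) := Real.one_le_sqrt.2 (by nlinarith [sq_nonneg (lam / 2)])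
  have h3 : √(1 + (lam / 2) ^ 2) ^ 2 = 1 + (lam / 2) ^ 2 := Real.sq_sqrt (by positivity)
  rw [h1, ← Real.sqrt_sq (sub_nonneg.2 h2)]
  congr 1
  linear_combination -h3

/-- **The central spectral gap of the Bernoulli displacement model.**  For every
`λ ≠ 0` and every configuration `ω ∈ {0,1}^ℤ`, the open interval
`(G₋(λ), G₊(λ))`, with `G_±(λ) = λ/2 ± √(2 + λ²/4 − √(4+λ²))`, is disjoint from
`σ(h_{ω,λ})`. -/
theorem bdm_spectral_gap
    (lam : ℝ) (hlam : lam ≠ 0)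
    (ω : ℤ → ℤ) (hω : ∀ k, ω k = 0 ∨ ω k = 1)
    (H : l2Z →L[ℝ] l2Z)
    (hH : ∀ (u : l2Z) (n : ℤ),
      (H u) n = -u (n - 1) - u (n + 1) + Vbdm lam ω n * u n) :
    ∀ E ∈ Set.Ioo
        (lam / 2 - Real.sqrt (2 + lam ^ 2 / 4 - Real.sqrt (4 + lam ^ 2)))
        (lam / 2 + Real.sqrt (2 + lam ^ 2 / 4 - Real.sqrt (4 + lam ^ 2))),
      E ∉ spectrum ℝ H := by
  intro E hE
  rw [sqrt_gap] at hE
  obtain ⟨hE1, hE2⟩ := hE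
  set r := √(1 + (lam / 2) ^ 2) with hr
  have hr2 : r ^ 2 = 1 + (lam / 2) ^ 2 := Real.sq_sqrt (by positivity)
  have hr0 : 0 < r := Real.sqrt_pos.2 (by positivity)
  set w : ℤ → ℝ := fun n => Vbdm lam ω n - lam / 2 with hw_def
  have hw : ∀ n, w (swapInside n) = -w n := fun n => by
    linear_combination Vbdm_add_swapInside lam hω n
  have hw2 : ∀ n, w n ^ 2 = (lam / 2) ^ 2 := fun n => by
    rcases Vbdm_eq_zero_or lam ω n with h | h <;> simp only [hw_def, h] <;> ring
  set B : l2Z →L[ℝ] l2Z := -(compInvolution swapAcross_involutive).toContinuousLinearMap with hB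
  have hBnorm : ‖B‖ ≤ 1 := by
    rw [hB, norm_neg]
    exact LinearIsometry.norm_toContinuousLinearMap_le _
  set A : l2Z →L[ℝ] l2Z := H - algebraMap ℝ _ (lam / 2) - B with hA_def
  have hA : ∀ u n, A u n = -u (swapInside n) + w n * u n := fun u n => by
    have h : A u n = H u n - lam / 2 * u n + u (swapAcross n) := by
      rw [hA_def, hB, sub_neg_eq_add]
      rfl
    rw [h, hH]
    linear_combination -swapAcross_add_swapInside u n
  have hAA : A * A = algebraMap ℝ _ (r ^ 2) := by
    ext u n
    change A (A u) n = r ^ 2 * u n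
    rw [hA, hA, hA, swapInside_involutive n, hw, hr2]
    linear_combination u n * hw2 n
  have hAr : ‖A‖ ≤ r := by
    refine A.opNorm_le_bound hr0.le fun u => ?_
    refine (sq_le_sq₀ (norm_nonneg _) (by positivity)).1 ?_
    rw [mul_pow, hr2, norm_sq_block swapInside_involutive hw hw2 (hA u)]
  have hC : ‖B - algebraMap ℝ (l2Z →L[ℝ] l2Z) (E - lam / 2)‖ < r := by
    have h1 : ‖algebraMap ℝ (l2Z →L[ℝ] l2Z) (E - lam / 2)‖ ≤ |E - lam / 2| := by
      refine ContinuousLinearMap.opNorm_le_bound _ (abs_nonneg _) fun u => ?_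
      exact (norm_smul (E - lam / 2) u).le
    have h2 : |E - lam / 2| < r - 1 := abs_lt.2 ⟨by linarith, by linarith⟩
    linarith [norm_sub_le B (algebraMap ℝ (l2Z →L[ℝ] l2Z) (E - lam / 2))]
  rw [spectrum.notMem_iff, IsUnit.sub_iff]
  convert isUnit_add_of_mul_self hr0 hAA hAr hC using 1
  rw [hA_def, map_sub]
  abel
end
end
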